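/- arXiv:1202.0435 — 9 statements merged into one kernel-verified Lean document; each statement's English description precedes it below -/
import Mathlib

section
/- Let Γ ≤ S_n act on ℝ^n by permuting coordinates and let S ⊆ ℝ^n be a Γ-symmetric convex set. Then S contains an integer point if and only if S contains a core point with respect to Γ. -/
/-- The standard permutation action of a permutation σ on ℝ^ι: `(σx)_i = x_{σ⁻¹(i)}`. -/
def permAct {ι : Type*} (σ : Equiv.Perm ι) (x : ι → ℝ) : ι → ℝ := fun i => x (σ⁻¹ i)

/-- The orbit `Γz` of a point under a permutation group. -/
def permOrbit {ι : Type*} (Γ : Subgroup (Equiv.Perm ι)) (z : ι → ℝ) : Set (ι → ℝ) :=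
  {w | ∃ γ ∈ Γ, w = permAct γ z}

/-- A point is integral if all its coordinates are integers. -/
def IsIntegralPoint {ι : Type*} (z : ι → ℝ) : Prop := ∀ i, ∃ m : ℤ, z i = (m : ℝ)

/-- A core point with respect to Γ: an integral point such that the convex hull of its
Γ-orbit contains no integral points other than the orbit points, i.e. conv(Γz) ∩ ℤ^n = Γz. -/
def IsCorePoint {ι : Type*} (Γ : Subgroup (Equiv.Perm ι)) (z : ι → ℝ) : Prop :=
  IsIntegralPoint z ∧
    ∀ y ∈ convexHull ℝ (permOrbit Γ z), IsIntegralPoint y → y ∈ permOrbit Γ z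

theorem sum_sq_permAct {ι : Type*} [Fintype ι] (σ : Equiv.Perm ι) (x : ι → ℝ) :
    ∑ i, permAct σ x i ^ 2 = ∑ i, x i ^ 2 :=
  Equiv.sum_comp σ⁻¹ fun i => x i ^ 2

/-- A point of the convex hull of an orbit that is at least as long as the orbit points
belongs to the orbit. -/
theorem mem_permOrbit_of_mem_convexHull {ι : Type*} [Fintype ι] {Γ : Subgroup (Equiv.Perm ι)}
    {y z : ι → ℝ} (hy : y ∈ convexHull ℝ (permOrbit Γ z))
    (hle : ∑ i, z i ^ 2 ≤ ∑ i, y i ^ 2) : y ∈ permOrbit Γ z := by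
  by_contra hyz
  have hhalf : Convex ℝ {x : ι → ℝ | y ⬝ᵥ x < y ⬝ᵥ y} :=
    convex_halfSpace_lt ⟨dotProduct_add y, fun c x => dotProduct_smul c y x⟩ _
  refine lt_irrefl (y ⬝ᵥ y) (convexHull_min ?_ hhalf hy)
  intro p hp
  have hpy : ∃ i, p i ≠ y i := by
    by_contra! h
    exact hyz (funext h ▸ hp)
  obtain ⟨j, hj⟩ := hpy
  obtain ⟨γ, -, rfl⟩ := hp
  have hpos : 0 < ∑ i, (permAct γ z i - y i) ^ 2 :=
    Finset.sum_pos' (fun i _ => sq_nonneg _) ⟨j, Finset.mem_univ j, by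
      have := sub_ne_zero.mpr hj
      positivity⟩
  have hexpand : ∑ i, (permAct γ z i - y i) ^ 2 =
      ∑ i, permAct γ z i ^ 2 - 2 * (y ⬝ᵥ permAct γ z) + ∑ i, y i ^ 2 := by
    rw [dotProduct, Finset.mul_sum, ← Finset.sum_sub_distrib, ← Finset.sum_add_distrib]
    exact Finset.sum_congr rfl fun i _ => by ring
  have hyy : y ⬝ᵥ y = ∑ i, y i ^ 2 := Finset.sum_congr rfl fun i _ => by ring
  rw [Set.mem_ofPred_eq]
  linarith [sum_sq_permAct γ z]

/-- A set containing an integral point contains a shortest integral point. -/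
theorem exists_shortest_integralPoint {ι : Type*} [Fintype ι] {S : Set (ι → ℝ)}
    (hS : ∃ z ∈ S, IsIntegralPoint z) :
    ∃ z ∈ S, IsIntegralPoint z ∧
      ∀ y ∈ S, IsIntegralPoint y → ∑ i, z i ^ 2 ≤ ∑ i, y i ^ 2 := by
  let sqLength : (ι → ℤ) → ℕ := fun m => ∑ i, (m i).natAbs ^ 2
  have hcast (m : ι → ℤ) : ((sqLength m : ℕ) : ℝ) = ∑ i, (m i : ℝ) ^ 2 := by
    simp [sqLength, Nat.cast_natAbs]
  obtain ⟨z, hz, hzint⟩ := hS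
  choose m hm using hzint
  obtain ⟨k, hk, hmin⟩ := (measure sqLength).wf.has_min
    {k : ι → ℤ | (fun i => (k i : ℝ)) ∈ S} ⟨m, by simpa [← hm] using hz⟩
  refine ⟨_, hk, fun i => ⟨k i, rfl⟩, fun y hy hyint => ?_⟩
  choose l hl using hyint
  obtain rfl : y = fun i => (l i : ℝ) := funext hl
  rw [← hcast, ← hcast]
  exact_mod_cast not_lt.mp (hmin l hy)

/-- Let Γ ≤ S_n act on ℝ^n by permuting coordinates and S ⊆ ℝ^n be a
Γ-symmetric convex set. Then S contains an integer point iff S contains a core point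
with respect to Γ. -/
theorem exists_integer_point_iff_exists_core_point {n : ℕ}
    (Γ : Subgroup (Equiv.Perm (Fin n))) (S : Set (Fin n → ℝ))
    (hconv : Convex ℝ S) (hsym : ∀ γ ∈ Γ, permAct γ '' S = S) :
    (∃ z ∈ S, IsIntegralPoint z) ↔ ∃ z ∈ S, IsCorePoint Γ z := by
  refine ⟨fun hS => ?_, fun ⟨z, hz, hcore⟩ => ⟨z, hz, hcore.1⟩⟩
  obtain ⟨z, hz, hzint, hmin⟩ := exists_shortest_integralPoint hS
  refine ⟨z, hz, hzint, fun y hy hyint => ?_⟩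
  have horbit : permOrbit Γ z ⊆ S := by
    rintro _ ⟨γ, hγ, rfl⟩
    exact hsym γ hγ ▸ Set.mem_image_of_mem _ hz
  exact mem_permOrbit_of_mem_convexHull hy (hmin y (convexHull_min horbit hconv hy) hyint)
end

section
/- Let Γ' ≤ Γ ≤ S_n act on ℝ^n by permuting coordinates. Then every core point with respect to Γ is also a core point with respect to Γ'; in particular, for every Γ-symmetric convex set C one has core_Γ(C) ⊆ core_{Γ'}(C). -/
theorem sum_permAct_mul_self {ι : Type*} [Fintype ι] (σ : Equiv.Perm ι) (x : ι → ℝ) :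
    ∑ i, permAct σ x i * permAct σ x i = ∑ i, x i * x i :=
  Equiv.sum_comp σ⁻¹ fun i => x i * x i

/-- A point of the convex hull of a subset of a Euclidean sphere that lies on the sphere itself
belongs to the subset. -/
theorem mem_of_mem_convexHull_of_sum_mul_self_eq {ι : Type*} [Fintype ι] {S : Set (ι → ℝ)}
    {R : ℝ} {y : ι → ℝ} (hS : ∀ w ∈ S, ∑ i, w i * w i = R) (hy : y ∈ convexHull ℝ S)
    (hyR : ∑ i, y i * y i = R) : y ∈ S := by
  by_contra hyS
  have hlin : IsLinearMap ℝ fun x : ι → ℝ => ∑ i, x i * y i :=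
    ⟨fun a b => by simp [add_mul, Finset.sum_add_distrib],
      fun c a => by simp [mul_assoc, Finset.mul_sum]⟩
  have hsub : S ⊆ {x | ∑ i, x i * y i < R} := by
    intro w hw
    obtain ⟨j, hj⟩ : ∃ j, w j ≠ y j := by
      by_contra! h
      exact hyS (funext h ▸ hw)
    have hpos : 0 < ∑ i, (w i - y i) ^ 2 :=
      Finset.sum_pos' (fun i _ => sq_nonneg _)
        ⟨j, Finset.mem_univ j, by have := sub_ne_zero.mpr hj; positivity⟩
    have hexp : ∑ i, (w i - y i) ^ 2
        = ∑ i, w i * w i - 2 * ∑ i, w i * y i + ∑ i, y i * y i := by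
      rw [Finset.mul_sum, ← Finset.sum_sub_distrib, ← Finset.sum_add_distrib]
      exact Finset.sum_congr rfl fun i _ => by ring
    have hwR := hS w hw
    simp only [Set.mem_ofPred_eq]
    linarith
  have hlt : ∑ i, y i * y i < R :=
    convexHull_min hsub (convex_halfSpace_lt hlin R) hy
  exact hlt.ne hyR

theorem permOrbit_mono {ι : Type*} {Γ' Γ : Subgroup (Equiv.Perm ι)} (hle : Γ' ≤ Γ)
    (z : ι → ℝ) : permOrbit Γ' z ⊆ permOrbit Γ z :=
  fun _ ⟨γ, hγ, hw⟩ => ⟨γ, hle hγ, hw⟩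

theorem sum_mul_self_of_mem_permOrbit {ι : Type*} [Fintype ι] {Γ : Subgroup (Equiv.Perm ι)}
    {z w : ι → ℝ} (hw : w ∈ permOrbit Γ z) : ∑ i, w i * w i = ∑ i, z i * z i := by
  obtain ⟨γ, -, rfl⟩ := hw
  exact sum_permAct_mul_self γ z

theorem IsCorePoint.mono {ι : Type*} [Fintype ι] {Γ' Γ : Subgroup (Equiv.Perm ι)}
    (hle : Γ' ≤ Γ) {z : ι → ℝ} (hz : IsCorePoint Γ z) : IsCorePoint Γ' z :=
  ⟨hz.1, fun y hy hint =>
    mem_of_mem_convexHull_of_sum_mul_self_eq (fun _ hw => sum_mul_self_of_mem_permOrbit hw) hy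
      (sum_mul_self_of_mem_permOrbit
        (hz.2 y (convexHull_mono (permOrbit_mono hle z) hy) hint))⟩

/-- For Γ' ≤ Γ ≤ S_n, every core point with respect to Γ is a core point
with respect to Γ'; in particular core_Γ(C) ⊆ core_{Γ'}(C) for every Γ-symmetric
convex set C. -/
theorem core_point_mono {n : ℕ}
    (Γ' Γ : Subgroup (Equiv.Perm (Fin n))) (hle : Γ' ≤ Γ) :
    (∀ z : Fin n → ℝ, IsCorePoint Γ z → IsCorePoint Γ' z) ∧
    (∀ C : Set (Fin n → ℝ), Convex ℝ C → (∀ γ ∈ Γ, permAct γ '' C = C) →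
      {z ∈ C | IsCorePoint Γ z} ⊆ {z ∈ C | IsCorePoint Γ' z}) :=
  ⟨fun _ hz => hz.mono hle, fun _ _ _ _ hz => ⟨hz.1, hz.2.mono hle⟩⟩
end

section
/- Let Γ = S_n act on ℝ^n by permuting coordinates, let 0 ≤ k < n, and let z ∈ ℤ^n satisfy Σ_{i=1}^n z_i = k. Then z is a core point with respect to S_n if and only if z ∈ {0,1}^n, i.e. every coordinate of z is 0 or 1. Hence the core set of the hyperplane H_{𝟙,k} = {x ∈ ℝ^n : ⟨x,𝟙⟩ = k} with respect to S_n is the set of 0/1-vectors with exactly k ones (the vertices of the hypersimplex). -/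
theorem permAct_mem_permOrbit_top {ι : Type*} (σ : Equiv.Perm ι) (z : ι → ℝ) :
    permAct σ z ∈ permOrbit (⊤ : Subgroup (Equiv.Perm ι)) z :=
  ⟨σ, Subgroup.mem_top σ, rfl⟩

theorem sum_comp_eq_of_mem_permOrbit {ι : Type*} [Fintype ι] {Γ : Subgroup (Equiv.Perm ι)}
    {y z : ι → ℝ} (h : y ∈ permOrbit Γ z) (f : ℝ → ℝ) : ∑ i, f (y i) = ∑ i, f (z i) := by
  obtain ⟨σ, -, rfl⟩ := h
  exact Equiv.sum_comp σ⁻¹ fun i => f (z i)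

/-- Coordinate bounds and the coordinate sum of an orbit pass to its
convex hull. -/
theorem mem_Icc_and_sum_eq_of_mem_convexHull_permOrbit {ι : Type*} [Fintype ι]
    {Γ : Subgroup (Equiv.Perm ι)} {y z : ι → ℝ} {a b : ℝ} (hz : ∀ i, z i ∈ Set.Icc a b)
    (hy : y ∈ convexHull ℝ (permOrbit Γ z)) :
    (∀ i, y i ∈ Set.Icc a b) ∧ ∑ i, y i = ∑ i, z i := by
  have hbox : Convex ℝ (Set.univ.pi fun _ : ι => Set.Icc a b) :=
    convex_pi fun _ _ => convex_Icc a b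
  have hsum : Convex ℝ {x : ι → ℝ | ∑ i, x i = ∑ i, z i} :=
    convex_hyperplane (f := fun x : ι → ℝ => ∑ i, x i)
      ⟨fun x y => by simp [Finset.sum_add_distrib], fun c x => by simp [Finset.mul_sum]⟩ _
  have hsub : permOrbit Γ z ⊆
      (Set.univ.pi fun _ : ι => Set.Icc a b) ∩ {x : ι → ℝ | ∑ i, x i = ∑ i, z i} := by
    intro w hw
    refine ⟨?_, sum_comp_eq_of_mem_permOrbit hw id⟩
    obtain ⟨σ, -, rfl⟩ := hw
    exact fun i _ => hz _
  have hmem := convexHull_min hsub (hbox.inter hsum) hy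
  exact ⟨fun i => hmem.1 i (Set.mem_univ i), hmem.2⟩

theorem IsIntegralPoint.of_zero_or_one {ι : Type*} {z : ι → ℝ} (hz : ∀ i, z i = 0 ∨ z i = 1) :
    IsIntegralPoint z := fun i =>
  (hz i).elim (fun h => ⟨0, by simp [h]⟩) fun h => ⟨1, by simp [h]⟩

theorem sum_eq_card_of_zero_or_one {ι : Type*} [Fintype ι] {z : ι → ℝ}
    [Fintype {i // z i = 1}] (hz : ∀ i, z i = 0 ∨ z i = 1) :
    ∑ i, z i = Fintype.card {i // z i = 1} := by
  classical
  rw [Fintype.card_subtype, ← Finset.sum_boole]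
  refine Finset.sum_congr rfl fun i _ => ?_
  rcases hz i with h | h <;> simp [h]

/-- Two 0/1-vectors with the same coordinate sum are permutations of each other. -/
theorem mem_permOrbit_top_of_zero_or_one {ι : Type*} [Fintype ι] {y z : ι → ℝ}
    (hy : ∀ i, y i = 0 ∨ y i = 1) (hz : ∀ i, z i = 0 ∨ z i = 1) (h : ∑ i, y i = ∑ i, z i) :
    y ∈ permOrbit (⊤ : Subgroup (Equiv.Perm ι)) z := by
  classical
  rw [sum_eq_card_of_zero_or_one hy, sum_eq_card_of_zero_or_one hz, Nat.cast_inj] at h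
  let e : {i // y i = 1} ≃ {i // z i = 1} := Fintype.equivOfCardEq h
  refine ⟨e.extendSubtype⁻¹, Subgroup.mem_top _, funext fun i => ?_⟩
  rw [permAct, inv_inv]
  by_cases hi : y i = 1
  · rw [hi, e.extendSubtype_mem i hi]
  · rw [(hy i).resolve_right hi, (hz _).resolve_right (e.extendSubtype_not_mem i hi)]

theorem IsCorePoint.of_zero_or_one {ι : Type*} [Fintype ι] {z : ι → ℝ}
    (hz : ∀ i, z i = 0 ∨ z i = 1) : IsCorePoint (⊤ : Subgroup (Equiv.Perm ι)) z := by
  refine ⟨.of_zero_or_one hz, fun y hy hyint => ?_⟩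
  have hzIcc : ∀ i, z i ∈ Set.Icc (0 : ℝ) 1 := fun i => by
    rcases hz i with h | h <;> simp [h]
  obtain ⟨hyIcc, hsum⟩ := mem_Icc_and_sum_eq_of_mem_convexHull_permOrbit hzIcc hy
  refine mem_permOrbit_top_of_zero_or_one (fun i => ?_) hz hsum
  obtain ⟨m, hm⟩ := hyint i
  obtain ⟨h0, h1⟩ := hyIcc i
  rw [hm] at h0 h1 ⊢
  norm_cast at h0 h1 ⊢
  lia

/-- The coordinates of a core point of the full symmetric group differ by at most one. -/
theorem IsCorePoint.le_add_one {ι : Type*} [Fintype ι] {z : ι → ℝ}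
    (hz : IsCorePoint (⊤ : Subgroup (Equiv.Perm ι)) z) (i j : ι) : z i ≤ z j + 1 := by
  classical
  by_contra! hlt
  have hij : i ≠ j := by rintro rfl; linarith
  have hd : 0 < z i - z j := by linarith
  let y : ι → ℝ := z + (Pi.single j 1 - Pi.single i 1)
  have hyi : y i = z i - 1 := by simp [y, hij]; ring
  have hyj : y j = z j + 1 := by simp [y, hij.symm]
  have hyl : ∀ l, l ≠ i → l ≠ j → y l = z l := fun l hi hj => by simp [y, hi, hj]
  have hyint : IsIntegralPoint y := fun l => by
    obtain ⟨m, hm⟩ := hz.1 l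
    by_cases hli : l = i
    · subst hli; exact ⟨m - 1, by rw [hyi, hm]; push_cast; ring⟩
    by_cases hlj : l = j
    · subst hlj; exact ⟨m + 1, by rw [hyj, hm]; push_cast; ring⟩
    exact ⟨m, by rw [hyl l hli hlj, hm]⟩
  have hyhull : y ∈ convexHull ℝ (permOrbit (⊤ : Subgroup (Equiv.Perm ι)) z) := by
    refine segment_subset_convexHull (permAct_mem_permOrbit_top 1 z)
      (permAct_mem_permOrbit_top (Equiv.swap i j) z)
      ⟨1 - (z i - z j)⁻¹, (z i - z j)⁻¹, ?_, by positivity, by ring, funext fun l => ?_⟩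
    · have := inv_le_one_of_one_le₀ (show 1 ≤ z i - z j by linarith)
      linarith
    · have hne := hd.ne'
      simp only [Pi.add_apply, Pi.smul_apply, smul_eq_mul, permAct, inv_one,
        Equiv.Perm.one_apply, Equiv.swap_inv]
      by_cases hli : l = i
      · subst hli; rw [hyi, Equiv.swap_apply_left]; field_simp; ring
      by_cases hlj : l = j
      · subst hlj; rw [hyj, Equiv.swap_apply_right]; field_simp; ring
      rw [hyl l hli hlj, Equiv.swap_apply_of_ne_of_ne hli hlj]; ring
  have hsq := sum_comp_eq_of_mem_permOrbit (hz.2 y hyhull hyint) (· ^ 2)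
  have hdiff : ∑ l, (y l ^ 2 - z l ^ 2) = (y i ^ 2 - z i ^ 2) + (y j ^ 2 - z j ^ 2) :=
    Fintype.sum_eq_add i j hij fun l hl => by rw [hyl l hl.1 hl.2, sub_self]
  rw [Finset.sum_sub_distrib, hyi, hyj] at hdiff
  nlinarith

theorem IsCorePoint.zero_or_one {ι : Type*} [Fintype ι] {z : ι → ℝ}
    (hz : IsCorePoint (⊤ : Subgroup (Equiv.Perm ι)) z) (h0 : 0 ≤ ∑ i, z i)
    (hcard : ∑ i, z i < Fintype.card ι) (i : ι) : z i = 0 ∨ z i = 1 := by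
  obtain ⟨m, hm⟩ := hz.1 i
  have hlow : -1 < m := by
    by_contra! h
    have hzi : z i ≤ -1 := by rw [hm]; exact_mod_cast h
    have : ∑ l, z l < ∑ _l : ι, (0 : ℝ) := Finset.sum_lt_sum
      (fun l _ => by linarith [hz.le_add_one l i]) ⟨i, Finset.mem_univ i, by linarith⟩
    simp only [Finset.sum_const_zero] at this
    linarith
  have hupp : m < 2 := by
    by_contra! h
    have hzi : 2 ≤ z i := by rw [hm]; exact_mod_cast h
    have : ∑ _l : ι, (1 : ℝ) ≤ ∑ l, z l :=
      Finset.sum_le_sum fun l _ => by linarith [hz.le_add_one i l]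
    simp only [Finset.sum_const, Finset.card_univ, nsmul_eq_mul, mul_one] at this
    linarith
  rw [hm]
  norm_cast
  lia

/-- For Γ = S_n, 0 ≤ k < n, and z ∈ ℤ^n with Σ z_i = k, z is a core point
with respect to S_n iff z is a 0/1-vector. Hence the core set of the hyperplane
H_{𝟙,k} with respect to S_n is the set of 0/1-vectors with exactly k ones. -/
theorem core_points_of_symmetric_group_are_zero_one {n : ℕ} (k : ℕ) (hk : k < n) :
    (∀ z : Fin n → ℝ, IsIntegralPoint z → (∑ i, z i) = (k : ℝ) →
      (IsCorePoint (⊤ : Subgroup (Equiv.Perm (Fin n))) z ↔ ∀ i, z i = 0 ∨ z i = 1)) ∧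
    {x : Fin n → ℝ | (∑ i, x i) = (k : ℝ) ∧ IsCorePoint (⊤ : Subgroup (Equiv.Perm (Fin n))) x}
      = {x : Fin n → ℝ | (∀ i, x i = 0 ∨ x i = 1) ∧ (∑ i, x i) = (k : ℝ)} := by
  have key : ∀ z : Fin n → ℝ, (∑ i, z i) = (k : ℝ) →
      (IsCorePoint (⊤ : Subgroup (Equiv.Perm (Fin n))) z ↔ ∀ i, z i = 0 ∨ z i = 1) :=
    fun z hsum => ⟨fun hz => hz.zero_or_one (by rw [hsum]; positivity)
      (by rw [hsum, Fintype.card_fin]; exact_mod_cast hk), .of_zero_or_one⟩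
  refine ⟨fun z _ hsum => key z hsum, Set.ext fun x => ?_⟩
  rw [Set.mem_ofPred_eq, Set.mem_ofPred_eq, and_comm]
  exact and_congr_left fun hsum => key x hsum
end

section
/- Let Γ₁ ≤ S_{n₁} and Γ₂ ≤ S_{n₂} act by permuting coordinates on the complementary coordinate subspaces X₁ = ℝ^{n₁} and X₂ = ℝ^{n₂} of ℝ^{n₁+n₂}, let Γ = Γ₁ × Γ₂ ≤ S_{n₁+n₂}, and let Y₁ ⊆ X₁, Y₂ ⊆ X₂ be Γ₁- respectively Γ₂-symmetric convex sets. Then core_Γ(Y₁ × Y₂) = core_{Γ₁}(Y₁) × core_{Γ₂}(Y₂); that is, an integral point (z₁, z₂) ∈ Y₁ × Y₂ is a core point with respect to Γ if and only if z₁ is a core point with respect to Γ₁ and z₂ is a core point with respect to Γ₂. -/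
theorem self_mem_permOrbit {ι : Type*} (Γ : Subgroup (Equiv.Perm ι)) (z : ι → ℝ) :
    z ∈ permOrbit Γ z :=
  ⟨1, Γ.one_mem, by ext i; simp [permAct]⟩

theorem isIntegralPoint_sumElim {ι κ : Type*} {y : ι → ℝ} {z : κ → ℝ} :
    IsIntegralPoint (Sum.elim y z) ↔ IsIntegralPoint y ∧ IsIntegralPoint z := by
  simp [IsIntegralPoint, Sum.forall]

theorem permAct_sumCongr {ι κ : Type*} (σ : Equiv.Perm ι) (τ : Equiv.Perm κ)
    (y : ι → ℝ) (z : κ → ℝ) :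
    permAct (Equiv.Perm.sumCongrHom ι κ (σ, τ)) (Sum.elim y z) =
      Sum.elim (permAct σ y) (permAct τ z) := by
  ext (i | i) <;> simp [permAct]

/-- The orbit of a point under a product of permutation groups is the product of the orbits. -/
theorem permOrbit_prod {ι κ : Type*} (Γ₁ : Subgroup (Equiv.Perm ι)) (Γ₂ : Subgroup (Equiv.Perm κ))
    (z₁ : ι → ℝ) (z₂ : κ → ℝ) :
    permOrbit (Subgroup.map (Equiv.Perm.sumCongrHom ι κ) (Γ₁.prod Γ₂)) (Sum.elim z₁ z₂) =
      (LinearEquiv.sumArrowLequivProdArrow ι κ ℝ ℝ).symm ''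
        (permOrbit Γ₁ z₁ ×ˢ permOrbit Γ₂ z₂) := by
  ext w
  constructor
  · rintro ⟨_, ⟨⟨σ, τ⟩, ⟨hσ, hτ⟩, rfl⟩, rfl⟩
    exact ⟨(permAct σ z₁, permAct τ z₂), ⟨⟨σ, hσ, rfl⟩, ⟨τ, hτ, rfl⟩⟩,
      (permAct_sumCongr σ τ z₁ z₂).symm⟩
  · rintro ⟨⟨_, _⟩, ⟨⟨σ, hσ, rfl⟩, ⟨τ, hτ, rfl⟩⟩, rfl⟩
    exact ⟨_, ⟨(σ, τ), ⟨hσ, hτ⟩, rfl⟩, (permAct_sumCongr σ τ z₁ z₂).symm⟩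

theorem sumElim_mem_permOrbit_prod {ι κ : Type*} {Γ₁ : Subgroup (Equiv.Perm ι)}
    {Γ₂ : Subgroup (Equiv.Perm κ)} {z₁ y₁ : ι → ℝ} {z₂ y₂ : κ → ℝ} :
    Sum.elim y₁ y₂ ∈
        permOrbit (Subgroup.map (Equiv.Perm.sumCongrHom ι κ) (Γ₁.prod Γ₂)) (Sum.elim z₁ z₂) ↔
      y₁ ∈ permOrbit Γ₁ z₁ ∧ y₂ ∈ permOrbit Γ₂ z₂ := by
  rw [permOrbit_prod]
  exact (LinearEquiv.sumArrowLequivProdArrow ι κ ℝ ℝ).symm.injective.mem_set_image (a := (y₁, y₂))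

theorem sumElim_mem_convexHull_permOrbit_prod {ι κ : Type*} {Γ₁ : Subgroup (Equiv.Perm ι)}
    {Γ₂ : Subgroup (Equiv.Perm κ)} {z₁ y₁ : ι → ℝ} {z₂ y₂ : κ → ℝ} :
    Sum.elim y₁ y₂ ∈ convexHull ℝ
        (permOrbit (Subgroup.map (Equiv.Perm.sumCongrHom ι κ) (Γ₁.prod Γ₂)) (Sum.elim z₁ z₂)) ↔
      y₁ ∈ convexHull ℝ (permOrbit Γ₁ z₁) ∧ y₂ ∈ convexHull ℝ (permOrbit Γ₂ z₂) := by
  have h := (LinearEquiv.sumArrowLequivProdArrow ι κ ℝ ℝ).symm.toLinearMap.image_convexHull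
    (permOrbit Γ₁ z₁ ×ˢ permOrbit Γ₂ z₂)
  rw [LinearEquiv.coe_coe] at h
  rw [permOrbit_prod, ← h, convexHull_prod]
  exact (LinearEquiv.sumArrowLequivProdArrow ι κ ℝ ℝ).symm.injective.mem_set_image (a := (y₁, y₂))

/-- For Γ = Γ₁ × Γ₂ acting on ℝ^{n₁+n₂} = ℝ^{n₁} × ℝ^{n₂} blockwise, and
Γᵢ-symmetric convex sets Yᵢ, an integral point (z₁, z₂) ∈ Y₁ × Y₂ is a core point with
respect to Γ iff z₁ is a core point with respect to Γ₁ and z₂ is one with respect to Γ₂;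
i.e. core_Γ(Y₁ × Y₂) = core_{Γ₁}(Y₁) × core_{Γ₂}(Y₂). -/
theorem core_point_prod_iff {n₁ n₂ : ℕ}
    (Γ₁ : Subgroup (Equiv.Perm (Fin n₁))) (Γ₂ : Subgroup (Equiv.Perm (Fin n₂)))
    (Y₁ : Set (Fin n₁ → ℝ)) (Y₂ : Set (Fin n₂ → ℝ))
    (hY₁c : Convex ℝ Y₁) (hY₂c : Convex ℝ Y₂)
    (hY₁s : ∀ γ ∈ Γ₁, permAct γ '' Y₁ = Y₁) (hY₂s : ∀ γ ∈ Γ₂, permAct γ '' Y₂ = Y₂)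
    (z₁ : Fin n₁ → ℝ) (z₂ : Fin n₂ → ℝ) (h₁ : z₁ ∈ Y₁) (h₂ : z₂ ∈ Y₂) :
    IsCorePoint
        (Subgroup.map (Equiv.Perm.sumCongrHom (Fin n₁) (Fin n₂)) (Γ₁.prod Γ₂))
        (Sum.elim z₁ z₂)
      ↔ IsCorePoint Γ₁ z₁ ∧ IsCorePoint Γ₂ z₂ := by
  constructor
  · rintro ⟨hz, hcore⟩
    obtain ⟨hz₁, hz₂⟩ := isIntegralPoint_sumElim.1 hz
    refine ⟨⟨hz₁, fun y hy hyi => ?_⟩, ⟨hz₂, fun y hy hyi => ?_⟩⟩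
    · exact (sumElim_mem_permOrbit_prod.1 <| hcore (Sum.elim y z₂)
        (sumElim_mem_convexHull_permOrbit_prod.2
          ⟨hy, subset_convexHull ℝ _ (self_mem_permOrbit Γ₂ z₂)⟩)
        (isIntegralPoint_sumElim.2 ⟨hyi, hz₂⟩)).1
    · exact (sumElim_mem_permOrbit_prod.1 <| hcore (Sum.elim z₁ y)
        (sumElim_mem_convexHull_permOrbit_prod.2
          ⟨subset_convexHull ℝ _ (self_mem_permOrbit Γ₁ z₁), hy⟩)
        (isIntegralPoint_sumElim.2 ⟨hz₁, hyi⟩)).2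
  · rintro ⟨⟨hz₁, hcore₁⟩, ⟨hz₂, hcore₂⟩⟩
    refine ⟨isIntegralPoint_sumElim.2 ⟨hz₁, hz₂⟩, fun y hy hyi => ?_⟩
    rw [← Sum.elim_comp_inl_inr y] at hy hyi ⊢
    obtain ⟨hy₁, hy₂⟩ := sumElim_mem_convexHull_permOrbit_prod.1 hy
    obtain ⟨hi₁, hi₂⟩ := isIntegralPoint_sumElim.1 hyi
    exact sumElim_mem_permOrbit_prod.2 ⟨hcore₁ _ hy₁ hi₁, hcore₂ _ hy₂ hi₂⟩
end

section
/- Let Γ = S_{k₁} × ⋯ × S_{k_d} ≤ S_n (with n = k₁ + ⋯ + k_d) act on ℝ^n by permuting coordinates within each of the d blocks. Then an integral point z ∈ ℤ^n is a core point with respect to Γ if and only if within each block i the coordinates of z take at most two values which differ by 1, i.e. max_j z_{i,j} − min_j z_{i,j} ≤ 1 for every block i. -/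
/-- The group S_{k₁} × ⋯ × S_{k_d} of permutations of Σ i, Fin (k i) permuting the
coordinates within each block independently. -/
def blockSymmetricGroup {d : ℕ} (k : Fin d → ℕ) :
    Subgroup (Equiv.Perm (Σ i : Fin d, Fin (k i))) :=
  (Equiv.Perm.sigmaCongrRightHom (fun i : Fin d => Fin (k i))).range

/-- Membership in the orbit under blockwise permutations, spelled out block by block. -/
theorem mem_permOrbit_blockSymmetricGroup_iff {d : ℕ} {k : Fin d → ℕ}
    {z y : (Σ i : Fin d, Fin (k i)) → ℝ} :
    y ∈ permOrbit (blockSymmetricGroup k) z ↔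
      ∃ τ : ∀ i, Equiv.Perm (Fin (k i)), ∀ i j, y ⟨i, j⟩ = z ⟨i, τ i j⟩ := by
  constructor
  · rintro ⟨_, ⟨τ, rfl⟩, rfl⟩
    exact ⟨fun i => (τ i)⁻¹, fun i j => rfl⟩
  · rintro ⟨τ, hτ⟩
    refine ⟨_, ⟨fun i => (τ i)⁻¹, rfl⟩, ?_⟩
    funext ⟨i, j⟩
    exact hτ i j

/-- Two functions with values in `{m, m + 1}` and the same sum agree up to a permutation. -/
theorem exists_perm_of_two_valued_of_sum_eq {α : Type*} [Fintype α] {f g : α → ℝ} {m : ℝ}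
    (hf : ∀ a, f a = m ∨ f a = m + 1) (hg : ∀ a, g a = m ∨ g a = m + 1)
    (h : ∑ a, g a = ∑ a, f a) : ∃ σ : Equiv.Perm α, ∀ a, g a = f (σ a) := by
  classical
  have sum_eq : ∀ u : α → ℝ, (∀ a, u a = m ∨ u a = m + 1) →
      ∑ a, u a = Fintype.card α * m + Fintype.card {a // u a = m + 1} := by
    intro u hu
    have hu' : ∀ a, u a = m + if u a = m + 1 then 1 else 0 := by
      intro a
      rcases hu a with h | h <;> simp [h]
    rw [Finset.sum_congr rfl fun a _ => hu' a, Finset.sum_add_distrib, Fintype.card_subtype]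
    simp
  have hcard : Fintype.card {a // g a = m + 1} = Fintype.card {a // f a = m + 1} := by
    have := sum_eq f hf
    have := sum_eq g hg
    exact_mod_cast (by linarith : (Fintype.card {a // g a = m + 1} : ℝ) =
      Fintype.card {a // f a = m + 1})
  let e := Fintype.equivOfCardEq hcard
  refine ⟨e.extendSubtype, fun a => ?_⟩
  by_cases ha : g a = m + 1
  · rw [ha, e.extendSubtype_mem a ha]
  · rw [(hg a).resolve_right ha, (hf _).resolve_right (e.extendSubtype_not_mem a ha)]

/-- An integer in the interval `[m, m + 1]` is one of its endpoints. -/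
theorem eq_or_eq_add_one_of_integral {x m : ℝ} (hx : ∃ a : ℤ, x = a) (hm : ∃ a : ℤ, m = a)
    (h₁ : m ≤ x) (h₂ : x ≤ m + 1) : x = m ∨ x = m + 1 := by
  obtain ⟨a, rfl⟩ := hx
  obtain ⟨b, rfl⟩ := hm
  norm_cast at *
  omega

/-- Points of the hull of the orbit keep the block sums and the blockwise bounds of `z`. -/
theorem sum_eq_and_bounds_of_mem_convexHull {d : ℕ} {k : Fin d → ℕ}
    {z y : (Σ i : Fin d, Fin (k i)) → ℝ} {m M : Fin d → ℝ}
    (hz : ∀ i j, m i ≤ z ⟨i, j⟩ ∧ z ⟨i, j⟩ ≤ M i)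
    (hy : y ∈ convexHull ℝ (permOrbit (blockSymmetricGroup k) z)) (i : Fin d) :
    ∑ j, y ⟨i, j⟩ = ∑ j, z ⟨i, j⟩ ∧ ∀ j, m i ≤ y ⟨i, j⟩ ∧ y ⟨i, j⟩ ≤ M i := by
  have hsub : permOrbit (blockSymmetricGroup k) z ⊆
      {y | ∑ j, y ⟨i, j⟩ = ∑ j, z ⟨i, j⟩ ∧ ∀ j, m i ≤ y ⟨i, j⟩ ∧ y ⟨i, j⟩ ≤ M i} := by
    intro w hw
    obtain ⟨τ, hτ⟩ := mem_permOrbit_blockSymmetricGroup_iff.1 hw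
    refine ⟨?_, fun j => ?_⟩
    · simp only [hτ]
      exact Equiv.sum_comp (τ i) fun j => z ⟨i, j⟩
    · rw [hτ]
      exact hz i _
  refine convexHull_min hsub ?_ hy
  rintro u ⟨hu, hu'⟩ v ⟨hv, hv'⟩ a b ha hb hab
  refine ⟨?_, fun j => ?_⟩
  · simp only [Pi.add_apply, Pi.smul_apply, smul_eq_mul, Finset.sum_add_distrib,
      ← Finset.mul_sum, hu, hv]
    rw [← add_mul, hab, one_mul]
  · exact (convex_Icc (m i) (M i)) (hu' j) (hv' j) ha hb hab

/-- In a core point, two coordinates of one block differ by at most one: otherwise moving a unit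
from the larger to the smaller one gives an integral point of the hull with a smaller norm. -/
theorem IsCorePoint.sub_le_one {d : ℕ} {k : Fin d → ℕ}
    {z : (Σ i : Fin d, Fin (k i)) → ℝ} (hz : IsCorePoint (blockSymmetricGroup k) z)
    (i : Fin d) (j j' : Fin (k i)) : z ⟨i, j⟩ - z ⟨i, j'⟩ ≤ 1 := by
  by_contra! hlt
  set p : Σ i : Fin d, Fin (k i) := ⟨i, j⟩ with hp
  set q : Σ i : Fin d, Fin (k i) := ⟨i, j'⟩ with hq
  have hpq : p ≠ q := by
    intro h
    rw [h] at hlt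
    linarith
  set D := z p - z q with hD
  let y : (Σ i : Fin d, Fin (k i)) → ℝ := z + (Pi.single q 1 - Pi.single p 1)
  have hswap : z ∘ Equiv.swap p q ∈ permOrbit (blockSymmetricGroup k) z := by
    refine mem_permOrbit_blockSymmetricGroup_iff.2
      ⟨Pi.mulSingle i (Equiv.swap j j'), fun a b => congrArg z ?_⟩
    by_cases ha : a = i
    · subst ha
      rw [Pi.mulSingle_eq_same]
      simp only [Equiv.swap_apply_def, hp, hq, Sigma.mk.injEq, heq_eq_eq, true_and]
      split_ifs <;> rfl
    · rw [Pi.mulSingle_eq_of_ne ha, Equiv.swap_apply_of_ne_of_ne]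
      · rfl
      · exact fun h => ha (congrArg Sigma.fst h)
      · exact fun h => ha (congrArg Sigma.fst h)
  have hself : z ∈ permOrbit (blockSymmetricGroup k) z :=
    mem_permOrbit_blockSymmetricGroup_iff.2 ⟨1, fun _ _ => rfl⟩
  have hyhull : y ∈ convexHull ℝ (permOrbit (blockSymmetricGroup k) z) := by
    have hDpos : 0 < D := by linarith
    have hinv : D⁻¹ ≤ 1 := inv_le_one_of_one_le₀ hlt.le
    have hyeq : y = (1 - D⁻¹) • z + D⁻¹ • (z ∘ Equiv.swap p q) := by
      funext r
      simp only [y, Pi.add_apply, Pi.sub_apply, Pi.smul_apply, smul_eq_mul, Function.comp_apply]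
      by_cases hrp : r = p
      · subst hrp
        rw [Pi.single_eq_same, Pi.single_eq_of_ne hpq, Equiv.swap_apply_left]
        have : z q = z p - D := by rw [hD]; ring
        rw [this]
        field_simp
        ring
      · by_cases hrq : r = q
        · subst hrq
          rw [Pi.single_eq_same, Pi.single_eq_of_ne hrp, Equiv.swap_apply_right]
          have : z p = z q + D := by rw [hD]; ring
          rw [this]
          field_simp
          ring
        · rw [Pi.single_eq_of_ne hrp, Pi.single_eq_of_ne hrq,
            Equiv.swap_apply_of_ne_of_ne hrp hrq]
          ring
    rw [hyeq]
    exact convex_convexHull ℝ _ (subset_convexHull ℝ _ hself) (subset_convexHull ℝ _ hswap)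
      (by linarith) (by positivity) (by ring)
  have hyint : IsIntegralPoint y := by
    intro r
    obtain ⟨a, ha⟩ := hz.1 r
    refine ⟨a + ((Pi.single q 1 : _ → ℤ) r - (Pi.single p 1 : _ → ℤ) r), ?_⟩
    simp [y, ha, Pi.single_apply]
  obtain ⟨γ, -, hγ⟩ := hz.2 y hyhull hyint
  have hsq : ∑ r, y r ^ 2 = ∑ r, z r ^ 2 := by
    rw [hγ]
    exact Equiv.sum_comp γ⁻¹ fun r => z r ^ 2
  have hsq' : ∑ r, y r ^ 2 = ∑ r, z r ^ 2 + (2 - 2 * D) := by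
    have hexp : ∀ r, y r ^ 2 = z r ^ 2 + ((2 * z r + 1) * Pi.single (M := fun _ => ℝ) q 1 r
        + (1 - 2 * z r) * Pi.single (M := fun _ => ℝ) p 1 r) := by
      intro r
      simp only [y, Pi.add_apply, Pi.sub_apply]
      by_cases hrp : r = p
      · subst hrp
        rw [Pi.single_eq_same, Pi.single_eq_of_ne hpq]
        ring
      · by_cases hrq : r = q
        · subst hrq
          rw [Pi.single_eq_same, Pi.single_eq_of_ne hrp]
          ring
        · rw [Pi.single_eq_of_ne hrp, Pi.single_eq_of_ne hrq]
          ring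
    rw [Finset.sum_congr rfl fun r _ => hexp r, Finset.sum_add_distrib, Finset.sum_add_distrib]
    simp only [Pi.single_apply, mul_ite, mul_one, mul_zero, Finset.sum_ite_eq', Finset.mem_univ,
      if_true]
    rw [hD]
    ring
  linarith

/-- For Γ = S_{k₁} × ⋯ × S_{k_d} acting blockwise on ℝ^n, an integral point
z is a core point with respect to Γ iff within each block the coordinates of z take at
most two values differing by 1, i.e. z_{i,j} − z_{i,j'} ≤ 1 for all blocks i and all j, j'. -/
theorem core_point_iff_block_coords_differ_by_at_most_one {d : ℕ} (k : Fin d → ℕ)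
    (z : (Σ i : Fin d, Fin (k i)) → ℝ) (hz : IsIntegralPoint z) :
    IsCorePoint (blockSymmetricGroup k) z
      ↔ ∀ (i : Fin d) (j j' : Fin (k i)), z ⟨i, j⟩ - z ⟨i, j'⟩ ≤ 1 := by
  refine ⟨fun h => h.sub_le_one, fun h => ⟨hz, fun y hy hyint => ?_⟩⟩
  have hmin : ∀ i, ∃ m : ℝ, (∃ a : ℤ, m = a) ∧ ∀ j, m ≤ z ⟨i, j⟩ ∧ z ⟨i, j⟩ ≤ m + 1 := by
    intro i
    rcases isEmpty_or_nonempty (Fin (k i)) with _ | _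
    · exact ⟨0, ⟨0, by simp⟩, isEmptyElim⟩
    · obtain ⟨j₀, hj₀⟩ := Finite.exists_min fun j => z ⟨i, j⟩
      exact ⟨z ⟨i, j₀⟩, hz _, fun j => ⟨hj₀ j, by linarith [h i j j₀]⟩⟩
  choose m hm hmz using hmin
  have hperm : ∀ i, ∃ σ : Equiv.Perm (Fin (k i)), ∀ j, y ⟨i, j⟩ = z ⟨i, σ j⟩ := by
    intro i
    obtain ⟨hsum, hbd⟩ := sum_eq_and_bounds_of_mem_convexHull hmz hy i
    exact exists_perm_of_two_valued_of_sum_eq (f := fun j => z ⟨i, j⟩) (g := fun j => y ⟨i, j⟩)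
      (fun j => eq_or_eq_add_one_of_integral (hz _) (hm i) (hmz i j).1 (hmz i j).2)
      (fun j => eq_or_eq_add_one_of_integral (hyint _) (hm i) (hbd j).1 (hbd j).2) hsum
  choose τ hτ using hperm
  exact mem_permOrbit_blockSymmetricGroup_iff.2 ⟨τ, hτ⟩
end

section
/- Let Γ ≤ S_n act transitively on the coordinates of ℝ^n. Then the core set of the hyperplane H_{𝟙,0} = {x ∈ ℝ^n : ⟨x,𝟙⟩ = 0} with respect to Γ is {0}, and for every k ∈ ℤ one has core_Γ(H_{𝟙,n−k}) = −core_Γ(H_{𝟙,k}) + 𝟙 and core_Γ(H_{𝟙,k+n}) = core_Γ(H_{𝟙,k}) + 𝟙. -/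
lemma permOrbit_map {ι : Type*} (Γ : Subgroup (Equiv.Perm ι)) {e : (ι → ℝ) → (ι → ℝ)}
    (hcomm : ∀ (γ : Equiv.Perm ι) (x : ι → ℝ), e (permAct γ x) = permAct γ (e x)) (z : ι → ℝ) :
    permOrbit Γ (e z) = e '' permOrbit Γ z := by
  ext w
  constructor
  · rintro ⟨γ, hγ, rfl⟩
    exact ⟨permAct γ z, ⟨γ, hγ, rfl⟩, hcomm γ z⟩
  · rintro ⟨_, ⟨γ, hγ, rfl⟩, rfl⟩
    exact ⟨γ, hγ, hcomm γ z⟩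

/-- Affine automorphisms that preserve the integer lattice and commute with coordinate
permutations preserve core points. -/
lemma isCorePoint_map_iff {ι : Type*} (Γ : Subgroup (Equiv.Perm ι))
    (e : (ι → ℝ) ≃ᵃ[ℝ] (ι → ℝ))
    (hcomm : ∀ (γ : Equiv.Perm ι) (x : ι → ℝ), e (permAct γ x) = permAct γ (e x))
    (hint : ∀ x, IsIntegralPoint (e x) ↔ IsIntegralPoint x) (z : ι → ℝ) :
    IsCorePoint Γ (e z) ↔ IsCorePoint Γ z := by
  have hhull : convexHull ℝ (e '' permOrbit Γ z) = e '' convexHull ℝ (permOrbit Γ z) :=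
    (e.toAffineMap.image_convexHull _).symm
  simp only [IsCorePoint, permOrbit_map Γ hcomm, hhull, Set.forall_mem_image, hint,
    e.injective.mem_set_image]

lemma isIntegralPoint_one_add_iff {ι : Type*} (x : ι → ℝ) :
    IsIntegralPoint (1 + x) ↔ IsIntegralPoint x := by
  refine forall_congr' fun i => ⟨?_, ?_⟩
  · rintro ⟨m, hm⟩
    refine ⟨m - 1, ?_⟩
    push_cast
    rw [← hm, Pi.add_apply, Pi.one_apply, add_sub_cancel_left]
  · rintro ⟨m, hm⟩
    exact ⟨1 + m, by simp [hm]⟩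

lemma isIntegralPoint_one_sub_iff {ι : Type*} (x : ι → ℝ) :
    IsIntegralPoint (1 - x) ↔ IsIntegralPoint x := by
  refine forall_congr' fun i => ⟨?_, ?_⟩
  · rintro ⟨m, hm⟩
    refine ⟨1 - m, ?_⟩
    push_cast
    rw [← hm, Pi.sub_apply, Pi.one_apply, sub_sub_cancel]
  · rintro ⟨m, hm⟩
    exact ⟨1 - m, by simp [hm]⟩

lemma isCorePoint_one_add_iff {ι : Type*} (Γ : Subgroup (Equiv.Perm ι)) (x : ι → ℝ) :
    IsCorePoint Γ (1 + x) ↔ IsCorePoint Γ x :=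
  isCorePoint_map_iff Γ (AffineEquiv.constVAdd ℝ (ι → ℝ) 1) (fun _ _ => rfl)
    isIntegralPoint_one_add_iff x

lemma isCorePoint_one_sub_iff {ι : Type*} (Γ : Subgroup (Equiv.Perm ι)) (x : ι → ℝ) :
    IsCorePoint Γ (1 - x) ↔ IsCorePoint Γ x :=
  isCorePoint_map_iff Γ (AffineEquiv.constVSub ℝ (1 : ι → ℝ)) (fun _ _ => rfl)
    isIntegralPoint_one_sub_iff x

/-- For a transitive group, the barycenter of the orbit of a point with coordinate sum zero
is the origin. -/
lemma zero_mem_convexHull_permOrbit {ι : Type*} [Fintype ι] (Γ : Subgroup (Equiv.Perm ι))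
    (htrans : ∀ i j : ι, ∃ γ ∈ Γ, γ i = j) {x : ι → ℝ} (hx : ∑ i, x i = 0) :
    (0 : ι → ℝ) ∈ convexHull ℝ (permOrbit Γ x) := by
  classical
  have := Fintype.ofFinite Γ
  have hconst : ∀ i j : ι, ∑ γ : Γ, x ((γ : Equiv.Perm ι)⁻¹ i)
      = ∑ γ : Γ, x ((γ : Equiv.Perm ι)⁻¹ j) := by
    intro i j
    obtain ⟨δ, hδ, rfl⟩ := htrans i j
    refine Fintype.sum_equiv (Equiv.mulLeft (⟨δ, hδ⟩ : Γ)) _ _ fun γ => ?_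
    simp [mul_inv_rev]
  have htotal : ∑ i, ∑ γ : Γ, x ((γ : Equiv.Perm ι)⁻¹ i) = 0 := by
    rw [Finset.sum_comm]
    exact Finset.sum_eq_zero fun γ _ => (Equiv.sum_comp _ x).trans hx
  have hzero : ∀ i, ∑ γ : Γ, x ((γ : Equiv.Perm ι)⁻¹ i) = 0 := by
    intro i
    have : Nonempty ι := ⟨i⟩
    rw [Finset.sum_congr rfl fun j _ => hconst j i] at htotal
    simpa using htotal
  have hbary : Finset.univ.centerMass (fun _ : Γ => (1 : ℝ))
      (fun γ : Γ => permAct (γ : Equiv.Perm ι) x) = 0 := by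
    ext i
    simpa [Finset.centerMass, permAct] using hzero i
  rw [← hbary]
  refine Finset.centerMass_mem_convexHull _ (fun _ _ => zero_le_one) ?_
    fun γ _ => ⟨γ, γ.2, rfl⟩
  simp [Fintype.card_pos]

lemma permOrbit_zero {ι : Type*} (Γ : Subgroup (Equiv.Perm ι)) :
    permOrbit Γ (0 : ι → ℝ) = {0} := by
  ext w
  exact ⟨fun ⟨_, _, hw⟩ => hw, fun hw => ⟨1, Γ.one_mem, hw⟩⟩

lemma isCorePoint_zero {ι : Type*} (Γ : Subgroup (Equiv.Perm ι)) :
    IsCorePoint Γ (0 : ι → ℝ) := by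
  refine ⟨fun _ => ⟨0, by simp⟩, fun y hy _ => ?_⟩
  rwa [permOrbit_zero, convexHull_singleton, ← permOrbit_zero Γ] at hy

lemma IsCorePoint.eq_zero_of_sum_eq_zero {ι : Type*} [Fintype ι] {Γ : Subgroup (Equiv.Perm ι)}
    (htrans : ∀ i j : ι, ∃ γ ∈ Γ, γ i = j) {x : ι → ℝ} (hcore : IsCorePoint Γ x)
    (hx : ∑ i, x i = 0) : x = 0 := by
  obtain ⟨γ, -, hγ⟩ := hcore.2 0 (zero_mem_convexHull_permOrbit Γ htrans hx)
    fun _ => ⟨0, by simp⟩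
  ext i
  simpa [permAct] using (congrFun hγ (γ i)).symm

/-- Let Γ ≤ S_n act transitively on the coordinates of ℝ^n. Then
core_Γ(H_{𝟙,0}) = {0}, and for every k ∈ ℤ one has
core_Γ(H_{𝟙,n−k}) = −core_Γ(H_{𝟙,k}) + 𝟙 and core_Γ(H_{𝟙,k+n}) = core_Γ(H_{𝟙,k}) + 𝟙. -/
theorem core_sets_of_transitive_group_hyperplanes {n : ℕ}
    (Γ : Subgroup (Equiv.Perm (Fin n)))
    (htrans : ∀ i j : Fin n, ∃ γ ∈ Γ, γ i = j) :
    ({x : Fin n → ℝ | (∑ i, x i) = 0 ∧ IsCorePoint Γ x} = {0}) ∧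
    (∀ k : ℤ,
      {x : Fin n → ℝ | (∑ i, x i) = ((n : ℝ) - (k : ℝ)) ∧ IsCorePoint Γ x}
        = (fun x : Fin n → ℝ => -x + fun _ => (1 : ℝ)) ''
            {x : Fin n → ℝ | (∑ i, x i) = (k : ℝ) ∧ IsCorePoint Γ x} ∧
      {x : Fin n → ℝ | (∑ i, x i) = ((k : ℝ) + (n : ℝ)) ∧ IsCorePoint Γ x}
        = (fun x : Fin n → ℝ => x + fun _ => (1 : ℝ)) ''
            {x : Fin n → ℝ | (∑ i, x i) = (k : ℝ) ∧ IsCorePoint Γ x}) := by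
  refine ⟨?_, fun k => ⟨?_, ?_⟩⟩
  · ext x
    refine ⟨fun ⟨hx, hcore⟩ => hcore.eq_zero_of_sum_eq_zero htrans hx, ?_⟩
    rintro rfl
    exact ⟨by simp, isCorePoint_zero Γ⟩
  · ext y
    constructor
    · rintro ⟨hy, hcore⟩
      refine ⟨1 - y, ⟨?_, (isCorePoint_one_sub_iff Γ y).2 hcore⟩, ?_⟩
      · simp [Finset.sum_sub_distrib, hy]
      · ext i
        simp
    · rintro ⟨x, ⟨hx, hcore⟩, rfl⟩
      refine ⟨?_, ?_⟩
      · simp [Finset.sum_add_distrib, hx]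
        ring
      · have h := (isCorePoint_one_sub_iff Γ x).2 hcore
        rwa [sub_eq_neg_add] at h
  · ext y
    constructor
    · rintro ⟨hy, hcore⟩
      refine ⟨y - 1, ⟨?_, ?_⟩, ?_⟩
      · simp [Finset.sum_sub_distrib, hy]
      · rwa [← isCorePoint_one_add_iff, add_sub_cancel]
      · ext i
        simp
    · rintro ⟨x, ⟨hx, hcore⟩, rfl⟩
      refine ⟨?_, ?_⟩
      · simp [Finset.sum_add_distrib, hx]
      · have h := (isCorePoint_one_add_iff Γ x).2 hcore
        rwa [add_comm] at h
end

section
/- Let n = 2m ≥ 4 and let Γ = ⟨σ⟩ ≤ S_n be the cyclic group of order n generated by the n-cycle σ = (n … 3 2 1), acting on ℝ^n by permuting coordinates. Then for every choice of integers a₂, …, a_m ∈ ℤ, the point z = (1, a₂, a₃, …, a_m, 0, −a₂, −a₃, …, −a_m) is a core point with respect to Γ, i.e. the orbit polytope conv(Γz) contains no integer points other than its vertices Γz. -/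
theorem permOrbit_zpowers_addRight {G : Type*} [AddCommGroup G] (s : G) (z : G → ℝ) :
    permOrbit (Subgroup.zpowers (Equiv.addRight s)⁻¹) z =
      {w | ∃ k ∈ AddSubgroup.zmultiples s, w = fun i => z (i + k)} := by
  ext w
  constructor
  · rintro ⟨_, ⟨j, rfl⟩, rfl⟩
    refine ⟨j • s, ⟨j, rfl⟩, funext fun i => ?_⟩
    simp [permAct]
  · rintro ⟨_, ⟨j, rfl⟩, rfl⟩
    refine ⟨_, ⟨j, rfl⟩, funext fun i => ?_⟩
    simp [permAct]

theorem exists_eq_translate_of_isIntegralPoint {G : Type*} [AddCommGroup G] [Fintype G]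
    [DecidableEq G] {h : G} (h0 : h ≠ 0) {z : G → ℝ} (z0 : z 0 = 1)
    (hz : ∀ i, z i + z (i + h) = (if i = 0 then 1 else 0) + (if i = h then 1 else 0))
    {c : G → ℝ} (c_nonneg : ∀ k, 0 ≤ c k) (c_sum : ∑ k, c k = 1)
    {y : G → ℝ} (hy : ∀ i, y i = ∑ k, c k * z (i + k)) (y_int : IsIntegralPoint y) :
    ∃ k, y = fun i => z (i + k) := by
  have zh : z h = 0 := by
    have := hz 0
    simp [z0, h0.symm] at this
    exact this
  obtain ⟨k₀, hk₀⟩ : ∃ k, 0 < c k := by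
    by_contra! H
    have : ∑ k, c k ≤ 0 := Finset.sum_nonpos fun k _ => H k
    linarith
  have hne : k₀ ≠ k₀ + h := by simpa using h0
  have pair_sum : y (-k₀) + y (-k₀ + h) = c k₀ + c (k₀ + h) := by
    rw [hy, hy, ← Finset.sum_add_distrib]
    have (k : G) : c k * z (-k₀ + k) + c k * z (-k₀ + h + k) =
        (if k = k₀ then c k else 0) + (if k = k₀ + h then c k else 0) := by
      rw [← mul_add, add_right_comm, hz]
      have e1 : -k₀ + k = 0 ↔ k = k₀ := by rw [neg_add_eq_zero, eq_comm]
      have e2 : -k₀ + k = h ↔ k = k₀ + h := neg_add_eq_iff_eq_add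
      simp [e1, e2, mul_add]
    simp [this, Finset.sum_add_distrib]
  obtain ⟨p, hp⟩ := y_int (-k₀)
  obtain ⟨q, hq⟩ := y_int (-k₀ + h)
  have pair_ge : 1 ≤ c k₀ + c (k₀ + h) := by
    have hpos : (0 : ℝ) < ((p + q : ℤ) : ℝ) := by
      push_cast
      linarith [c_nonneg (k₀ + h)]
    have : 1 ≤ p + q := Int.cast_pos.mp hpos
    have : (1 : ℝ) ≤ ((p + q : ℤ) : ℝ) := by exact_mod_cast this
    push_cast at this
    linarith
  have c_zero : ∀ k, k ≠ k₀ → k ≠ k₀ + h → c k = 0 := by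
    intro k h1 h2
    have : ∑ i ∈ {k, k₀, k₀ + h}, c i ≤ ∑ i, c i :=
      Finset.sum_le_sum_of_subset_of_nonneg (Finset.subset_univ _) fun i _ _ => c_nonneg i
    rw [Finset.sum_insert (by simp [h1, h2]), Finset.sum_pair hne] at this
    linarith [c_nonneg k]
  have value : y (-k₀) = c k₀ := by
    rw [hy, Finset.sum_eq_single k₀]
    · simp [z0]
    · intro k _ hk
      by_cases hk' : k = k₀ + h
      · simp [hk', zh]
      · simp [c_zero k hk hk']
    · simp
  have c_one : 1 ≤ c k₀ := by
    rw [← value, hp] at hk₀ ⊢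
    exact_mod_cast Int.cast_pos.mp hk₀
  have c_zero' : ∀ k, k ≠ k₀ → c k = 0 := by
    intro k hk
    have : ∑ i ∈ {k, k₀}, c i ≤ ∑ i, c i :=
      Finset.sum_le_sum_of_subset_of_nonneg (Finset.subset_univ _) fun i _ _ => c_nonneg i
    rw [Finset.sum_pair hk] at this
    linarith [c_nonneg k]
  have c_eq : c k₀ = 1 := by
    rw [← c_sum, Finset.sum_eq_single k₀ (fun k _ hk => c_zero' k hk) (by simp)]
  refine ⟨k₀, funext fun i => ?_⟩
  rw [hy, Finset.sum_eq_single k₀ (fun k _ hk => by simp [c_zero' k hk]) (by simp), c_eq, one_mul]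

theorem exists_weights_of_mem_convexHull_translates {G : Type*} [AddCommGroup G] [Fintype G]
    {z y : G → ℝ} (hy : y ∈ convexHull ℝ (Set.range fun k i => z (i + k))) :
    ∃ c : G → ℝ, (∀ k, 0 ≤ c k) ∧ ∑ k, c k = 1 ∧ ∀ i, y i = ∑ k, c k * z (i + k) := by
  classical
  rw [convexHull_range_eq_exists_affineCombination] at hy
  obtain ⟨s, w, hw, hw1, rfl⟩ := hy
  refine ⟨fun k => if k ∈ s then w k else 0, fun k => ?_, by simpa using hw1, fun i => ?_⟩
  · dsimp only
    split_ifs with hk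
    exacts [hw k hk, le_rfl]
  · rw [Finset.affineCombination_eq_linear_combination _ _ _ hw1]
    simp [Finset.sum_apply]

theorem isCorePoint_zpowers_addRight {G : Type*} [AddCommGroup G] [Fintype G]
    [DecidableEq G] {s : G} (hs : ∀ k, k ∈ AddSubgroup.zmultiples s)
    {h : G} (h0 : h ≠ 0) {z : G → ℝ} (z_int : IsIntegralPoint z) (z0 : z 0 = 1)
    (hz : ∀ i, z i + z (i + h) = (if i = 0 then 1 else 0) + (if i = h then 1 else 0)) :
    IsCorePoint (Subgroup.zpowers (Equiv.addRight s)⁻¹) z := by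
  have orbit_eq : permOrbit (Subgroup.zpowers (Equiv.addRight s)⁻¹) z =
      Set.range fun k i => z (i + k) := by
    ext w
    rw [permOrbit_zpowers_addRight]
    simp [hs, eq_comm]
  refine ⟨z_int, fun y hy y_int => ?_⟩
  rw [orbit_eq] at hy ⊢
  obtain ⟨c, c_nonneg, c_sum, hc⟩ := exists_weights_of_mem_convexHull_translates hy
  obtain ⟨k, rfl⟩ :=
    exists_eq_translate_of_isIntegralPoint h0 z0 hz c_nonneg c_sum hc y_int
  exact ⟨k, rfl⟩

theorem finRotate_eq_addRight_one (n : ℕ) [NeZero n] :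
    finRotate n = Equiv.addRight (1 : Fin n) := by
  ext i
  simp [finRotate_apply]

/-- Let n = 2m ≥ 4 and Γ = ⟨σ⟩ ≤ S_n be the cyclic group generated by the
n-cycle σ = (n … 3 2 1) (i.e. σ sends position i to i−1 cyclically, which in 0-indexed
form is the inverse of `finRotate`). Then for all integers a₂, …, a_m the point
z = (1, a₂, …, a_m, 0, −a₂, …, −a_m) is a core point with respect to Γ. -/
theorem cyclic_group_core_point_family {m : ℕ} (hm : 2 ≤ m) (a : ℕ → ℤ) :
    IsCorePoint (Subgroup.zpowers ((finRotate (2 * m))⁻¹))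
      (fun p : Fin (2 * m) =>
        if (p : ℕ) = 0 then 1
        else if (p : ℕ) < m then (a ((p : ℕ) + 1) : ℝ)
        else if (p : ℕ) = m then 0
        else -(a ((p : ℕ) - m + 1) : ℝ)) := by
  have : NeZero (2 * m) := ⟨by omega⟩
  have val_add_half (i : Fin (2 * m)) :
      ((i + ⟨m, by omega⟩ : Fin (2 * m)) : ℕ) = if (i : ℕ) < m then i + m else i - m := by
    rw [Fin.val_add]
    have := i.isLt
    split_ifs with hi
    · exact Nat.mod_eq_of_lt (by dsimp only; omega)
    · rw [Nat.mod_eq_sub_mod (by dsimp only; omega)]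
      dsimp only
      rw [Nat.mod_eq_of_lt (by omega)]
      omega
  rw [finRotate_eq_addRight_one]
  refine isCorePoint_zpowers_addRight (h := ⟨m, by omega⟩) (fun k => ?_) ?_ (fun i => ?_)
    (by simp) (fun i => ?_)
  · refine ⟨(k : ℕ), ?_⟩
    open Fin.CommRing in simp
  · simp only [ne_eq, Fin.ext_iff, Fin.val_zero]
    omega
  · split_ifs
    exacts [⟨1, by simp⟩, ⟨a (i + 1), rfl⟩, ⟨0, by simp⟩, ⟨-a (i - m + 1), by simp⟩]
  · have hi := i.isLt
    simp only [val_add_half, Fin.ext_iff, Fin.val_zero]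
    rcases lt_or_ge (i : ℕ) m with h | h
    · by_cases h' : (i : ℕ) = 0
      · simp [h', show m ≠ 0 by omega, show 0 < m by omega, show (0 : ℕ) ≠ m by omega]
      · simp [h, h', h.ne]
    · by_cases h' : (i : ℕ) = m
      · simp [h', show m ≠ 0 by omega]
      · simp [h', show ¬ (i : ℕ) < m by omega, show (i : ℕ) ≠ 0 by omega,
          show (i : ℕ) - m ≠ 0 by omega, show (i : ℕ) - m < m by omega]
end

section
/- Let n = 2m ≥ 4 and let Γ ≤ S_n be the cyclic group of order n generated by the n-cycle σ = (n … 3 2 1), acting on ℝ^n by permuting coordinates. Then the set of core points with respect to Γ lying in the hyperplane H_{𝟙,1} = {x ∈ ℝ^n : ⟨x,𝟙⟩ = 1} is infinite; in particular Γ does not have a finite core set. -/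
/-- The alternating sign vector `(1, -1, 1, -1, …)`. -/
def altSign {n : ℕ} (i : Fin n) : ℝ := (-1) ^ i.val

/-- The lattice point `e_p + k · altSign p · altSign`. -/
def altPoint {n : ℕ} (k : ℝ) (p : Fin n) : Fin n → ℝ :=
  fun i => Pi.single (M := fun _ => ℝ) p 1 i + k * (altSign p * altSign i)

/-- The linear map sending the basis vector `e_p` to `altPoint k p`. -/
def altMap {n : ℕ} (k : ℝ) : (Fin n → ℝ) →ₗ[ℝ] (Fin n → ℝ) where
  toFun x := fun i => x i + k * ((∑ p, x p * altSign p) * altSign i)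
  map_add' x y := by
    ext i
    simp only [Pi.add_apply, add_mul, Finset.sum_add_distrib]
    ring
  map_smul' c x := by
    ext i
    simp only [Pi.smul_apply, smul_eq_mul, RingHom.id_apply, mul_assoc, ← Finset.mul_sum]
    ring

lemma altMap_single {n : ℕ} (k : ℝ) (p : Fin n) :
    altMap k (Pi.single p 1) = altPoint k p := by
  ext i
  simp [altMap, altPoint, Pi.single_apply]

lemma altSign_mul_self {n : ℕ} (i : Fin n) : altSign i * altSign i = 1 := by
  rw [altSign, ← mul_pow]
  simp

lemma altSign_add {m : ℕ} (i j : Fin (2 * m)) :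
    altSign (i + j) = altSign i * altSign j := by
  rw [altSign, altSign, altSign, Fin.val_add, ← pow_add, neg_one_pow_eq_pow_mod_two,
    Nat.mod_mul_right_mod, ← neg_one_pow_eq_pow_mod_two]

lemma isIntegralPoint_altPoint {n : ℕ} (k : ℕ) (p : Fin n) : IsIntegralPoint (altPoint k p) := by
  intro i
  refine ⟨(if i = p then 1 else 0) + k * ((-1) ^ p.val * (-1) ^ i.val), ?_⟩
  simp [altPoint, altSign, Pi.single_apply]

section NeZero

variable {m : ℕ} [NeZero (2 * m)]

lemma altSign_sub (i j : Fin (2 * m)) : altSign (i - j) = altSign i * altSign j := by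
  have h := altSign_add (i - j) j
  rw [sub_add_cancel] at h
  rw [h, mul_assoc, altSign_mul_self, mul_one]

lemma altSign_one (hm : 2 ≤ m) : altSign (1 : Fin (2 * m)) = -1 := by
  rw [altSign, Fin.val_one', Nat.mod_eq_of_lt (by omega), pow_one]

lemma sum_altSign (hm : 2 ≤ m) : ∑ i : Fin (2 * m), altSign i = 0 := by
  have h := Equiv.sum_comp (Equiv.addRight (1 : Fin (2 * m))) altSign
  simp only [Equiv.coe_addRight, altSign_add, altSign_one hm, ← Finset.sum_mul] at h
  linarith

lemma finRotate_pow_apply (j : ℕ) (i : Fin (2 * m)) :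
    (finRotate (2 * m) ^ j) i = i + Fin.ofNat (2 * m) j := by
  induction j with
  | zero => simp
  | succ j ih =>
    rw [pow_succ', Equiv.Perm.mul_apply, ih, finRotate_apply, add_assoc]
    congr 1
    ext
    simp [Fin.val_add]

lemma permOrbit_altPoint_zero (k : ℝ) :
    permOrbit (Subgroup.zpowers (finRotate (2 * m))⁻¹) (altPoint k 0) =
      Set.range (altPoint k) := by
  have key (j : ℕ) : permAct (finRotate (2 * m) ^ j) (altPoint k 0) =
      altPoint k (Fin.ofNat (2 * m) j) := by
    ext i
    have h : (finRotate (2 * m) ^ j)⁻¹ i = i - Fin.ofNat (2 * m) j := by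
      rw [Equiv.Perm.inv_eq_iff_eq, finRotate_pow_apply, sub_add_cancel]
    have h0 : altSign (0 : Fin (2 * m)) = 1 := by simp [altSign]
    simp only [permAct, altPoint, h, Pi.single_apply, sub_eq_zero, altSign_sub, h0]
    ring
  rw [Subgroup.zpowers_inv]
  ext w
  constructor
  · rintro ⟨γ, hγ, rfl⟩
    obtain ⟨j, rfl⟩ := mem_powers_iff_mem_zpowers.2 hγ
    exact ⟨_, (key j).symm⟩
  · rintro ⟨p, rfl⟩
    refine ⟨finRotate (2 * m) ^ p.val, Subgroup.npow_mem_zpowers _ _, ?_⟩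
    rw [key, Fin.ofNat_val_eq_self]

/-- A point of the standard simplex whose neighbouring coordinates have integral sums is a
vertex, provided there are at least four coordinates. -/
lemma exists_eq_single_of_mem_stdSimplex (hm : 2 ≤ m) {x : Fin (2 * m) → ℝ}
    (hx : x ∈ stdSimplex ℝ (Fin (2 * m)))
    (hint : ∀ i, ∃ a : ℤ, x i + x (i + 1) = a) : ∃ p, x = Pi.single p 1 := by
  obtain ⟨hnn, hsum⟩ := hx
  obtain ⟨p, -, hp⟩ : ∃ p ∈ Finset.univ, 0 < x p :=
    Finset.exists_lt_of_sum_lt (by simp [hsum])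
  have h1 : (1 : Fin (2 * m)) ≠ 0 := by
    rw [Ne, Fin.ext_iff, Fin.val_one', Nat.mod_eq_of_lt (by omega)]
    simp
  have h2 : (1 : Fin (2 * m)) + 1 ≠ 0 := by
    rw [Ne, Fin.ext_iff, Fin.val_add, Fin.val_one', Nat.mod_eq_of_lt (a := 1) (by omega),
      Nat.mod_eq_of_lt (by omega)]
    simp
  have hd1 : p ≠ p + 1 := by simp [h1]
  have hd2 : p ≠ p - 1 := fun h => hd1 (eq_sub_iff_add_eq.1 h).symm
  have hd3 : p + 1 ≠ p - 1 := by
    intro h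
    apply h2
    have : p + (1 + 1) = p := by rw [← add_assoc, h, sub_add_cancel]
    simpa using this
  have hthree : x p + (x (p + 1) + x (p - 1)) ≤ 1 := by
    have := Finset.sum_le_univ_sum_of_nonneg (s := {p, p + 1, p - 1}) hnn
    rwa [hsum, Finset.sum_insert (by simp [hd1, hd2]), Finset.sum_pair hd3] at this
  have hone {b : ℝ} (h : ∃ a : ℤ, b = a) (h0 : 0 < b) : 1 ≤ b := by
    obtain ⟨a, rfl⟩ := h
    exact_mod_cast Int.cast_pos.1 h0
  have hr := hone (hint p) (by linarith [hnn (p + 1)])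
  have hl := hone (hint (p - 1)) (by rw [sub_add_cancel]; linarith [hnn (p - 1)])
  rw [sub_add_cancel] at hl
  have hp1 : x p = 1 := by linarith [hnn (p + 1), hnn (p - 1)]
  refine ⟨p, ?_⟩
  ext q
  rcases eq_or_ne q p with rfl | hq
  · simp [hp1]
  · have := Finset.sum_le_univ_sum_of_nonneg (s := {p, q}) hnn
    rw [hsum, Finset.sum_pair hq.symm] at this
    rw [Pi.single_eq_of_ne hq]
    linarith [hnn q]

lemma isCorePoint_altPoint_zero (hm : 2 ≤ m) (k : ℕ) :
    IsCorePoint (Subgroup.zpowers (finRotate (2 * m))⁻¹) (altPoint k 0) := by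
  refine ⟨isIntegralPoint_altPoint k 0, ?_⟩
  rw [permOrbit_altPoint_zero]
  intro y hy hyint
  have hsub : Set.range (altPoint (n := 2 * m) k) ⊆ altMap k '' stdSimplex ℝ (Fin (2 * m)) := by
    rintro _ ⟨p, rfl⟩
    exact ⟨Pi.single p 1, single_mem_stdSimplex ℝ p, altMap_single _ p⟩
  obtain ⟨x, hx, rfl⟩ :=
    convexHull_min hsub ((convex_stdSimplex ℝ (Fin (2 * m))).linear_image (altMap (k : ℝ))) hy
  obtain ⟨p, rfl⟩ := exists_eq_single_of_mem_stdSimplex hm hx fun i => by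
    obtain ⟨a, ha⟩ := hyint i
    obtain ⟨b, hb⟩ := hyint (i + 1)
    refine ⟨a + b, ?_⟩
    rw [Int.cast_add, ← ha, ← hb]
    simp only [altMap, LinearMap.coe_mk, AddHom.coe_mk, altSign_add, altSign_one hm]
    ring
  exact ⟨p, (altMap_single _ p).symm⟩

end NeZero

/-- Let n = 2m ≥ 4 and Γ ≤ S_n be the cyclic group of order n generated by
the n-cycle σ = (n … 3 2 1). Then the set of core points with respect to Γ lying in the
hyperplane H_{𝟙,1} = {x : ⟨x,𝟙⟩ = 1} is infinite; in particular Γ does not have a finite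
core set. -/
theorem cyclic_group_infinite_core_set {m : ℕ} (hm : 2 ≤ m) :
    {z : Fin (2 * m) → ℝ |
      IsCorePoint (Subgroup.zpowers ((finRotate (2 * m))⁻¹)) z ∧ (∑ i, z i) = 1}.Infinite := by
  have : NeZero (2 * m) := ⟨by omega⟩
  refine Set.infinite_of_injective_forall_mem (f := fun k : ℕ => altPoint (k : ℝ) 0) ?_ ?_
  · intro k l h
    simpa [altPoint, altSign] using congrFun h 0
  · intro k
    refine ⟨isCorePoint_altPoint_zero hm k, ?_⟩
    simp [altPoint, Finset.sum_add_distrib, ← Finset.mul_sum, sum_altSign hm]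
end

section
/- Let Γ = S_{k₁} × ⋯ × S_{k_d} ≤ S_n (with n = k₁ + ⋯ + k_d) act on ℝ^n by permuting coordinates within each block, and let Φ_Γ be the orthogonal projection onto the fixed space Fix_Γ(ℝ^n). Then for every x in Φ_Γ(ℤ^n), the set of all core points with respect to Γ contained in the fiber Φ_Γ^{-1}(x) forms a single Γ-orbit; in particular any two core points in the same Γ-fiber differ by an element of Γ. -/
/-- The orthogonal projection onto the fixed space of S_{k₁} × ⋯ × S_{k_d}:
Φ_Γ(v) = (1/|Γ|) Σ_{γ∈Γ} γv. -/
noncomputable def blockFixProj {d : ℕ} (k : Fin d → ℕ)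
    (v : (Σ i : Fin d, Fin (k i)) → ℝ) : (Σ i : Fin d, Fin (k i)) → ℝ :=
  (Nat.card (blockSymmetricGroup k) : ℝ)⁻¹ •
    ∑ γ ∈ (Set.toFinite
        ((blockSymmetricGroup k : Subgroup (Equiv.Perm (Σ i : Fin d, Fin (k i)))) :
          Set (Equiv.Perm (Σ i : Fin d, Fin (k i))))).toFinset,
      permAct γ v

section EquidistributedTuples

/-- An integer tuple whose entries differ pairwise by at most one takes only the values `q` and
`q + 1`, where `q` is the floor of its mean. -/
theorem mem_Icc_of_le_add_one {α : Type*} [Fintype α] {f : α → ℤ}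
    (hf : ∀ a b, f a ≤ f b + 1) {q : ℤ} (hq : Fintype.card α * q ≤ ∑ a, f a)
    (hq' : ∑ a, f a < Fintype.card α * (q + 1)) (a : α) : q ≤ f a ∧ f a ≤ q + 1 := by
  constructor
  · by_contra! h
    have : ∑ b, f b < ∑ _b : α, q :=
      Finset.sum_lt_sum (fun b _ => by have := hf b a; omega) ⟨a, Finset.mem_univ a, h⟩
    simp at this
    omega
  · by_contra! h
    have : ∑ _b : α, (q + 1) ≤ ∑ b, f b :=
      Finset.sum_le_sum (fun b _ => by have := hf a b; omega)
    simp at this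
    omega

/-- Two integer tuples with the same sum, in each of which the entries differ pairwise by at most
one, are rearrangements of each other. -/
theorem exists_perm_of_sum_eq {α : Type*} [Fintype α] {f g : α → ℤ}
    (hf : ∀ a b, f a ≤ f b + 1) (hg : ∀ a b, g a ≤ g b + 1) (h : ∑ a, f a = ∑ a, g a) :
    ∃ σ : Equiv.Perm α, ∀ a, g (σ a) = f a := by
  classical
  rcases isEmpty_or_nonempty α with hα | hα
  · exact ⟨1, fun a => hα.elim a⟩
  have hpos : (0 : ℤ) < Fintype.card α := by exact_mod_cast Fintype.card_pos
  obtain ⟨q, hq, hq'⟩ : ∃ q : ℤ, Fintype.card α * q ≤ ∑ a, f a ∧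
      ∑ a, f a < Fintype.card α * (q + 1) :=
    ⟨(∑ a, f a) / Fintype.card α, Int.mul_ediv_self_le hpos.ne',
      by linarith [Int.lt_mul_ediv_self_add (x := ∑ a, f a) hpos]⟩
  have hfq := mem_Icc_of_le_add_one hf hq hq'
  have hgq := mem_Icc_of_le_add_one hg (h ▸ hq) (h ▸ hq')
  have count : ∀ u : α → ℤ, (∀ a, q ≤ u a ∧ u a ≤ q + 1) →
      ((Finset.univ.filter fun a => u a = q + 1).card : ℤ) = ∑ a, u a - Fintype.card α * q ∧
      ((Finset.univ.filter fun a => u a = q).card : ℤ) =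
        Fintype.card α * (q + 1) - ∑ a, u a := by
    intro u hu
    constructor
    · have : ∀ a, (if u a = q + 1 then (1 : ℤ) else 0) = u a - q := fun a => by
        have := hu a
        split_ifs <;> omega
      rw [← Finset.sum_boole, Finset.sum_congr rfl fun a _ => this a]
      simp
    · have : ∀ a, (if u a = q then (1 : ℤ) else 0) = q + 1 - u a := fun a => by
        have := hu a
        split_ifs <;> omega
      rw [← Finset.sum_boole, Finset.sum_congr rfl fun a _ => this a]
      simp
  have hcard : ∀ c, Fintype.card {a // f a = c} = Fintype.card {a // g a = c} := by
    intro c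
    rw [Fintype.card_subtype, Fintype.card_subtype]
    by_cases h1 : c = q + 1
    · subst h1
      have := (count f hfq).1
      have := (count g hgq).1
      omega
    by_cases h0 : c = q
    · subst h0
      have := (count f hfq).2
      have := (count g hgq).2
      omega
    have hempty : ∀ u : α → ℤ, (∀ a, q ≤ u a ∧ u a ≤ q + 1) →
        (Finset.univ.filter fun a => u a = c) = ∅ := fun u hu =>
      Finset.filter_eq_empty_iff.2 fun a _ ha => by have := hu a; omega
    rw [hempty f hfq, hempty g hgq]
  exact ⟨Equiv.ofFiberEquiv fun c => Fintype.equivOfCardEq (hcard c),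
    fun a => Equiv.ofFiberEquiv_map _ a⟩

/-- Every integer is the sum of an integer tuple of given positive length whose entries differ
pairwise by at most one. -/
theorem exists_sum_eq_of_le_add_one {n : ℕ} (hn : 0 < n) (s : ℤ) :
    ∃ f : Fin n → ℤ, (∀ a b, f a ≤ f b + 1) ∧ ∑ a, f a = s := by
  have hpos : (0 : ℤ) < n := by exact_mod_cast hn
  have h0 := Int.emod_nonneg s hpos.ne'
  have h1 := Int.emod_lt_of_pos s hpos
  obtain ⟨r, hr⟩ := Int.eq_ofNat_of_zero_le h0
  refine ⟨fun a => s / n + if (a : ℕ) < r then 1 else 0, fun a b => ?_, ?_⟩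
  · dsimp only
    split_ifs <;> omega
  · rw [Finset.sum_add_distrib, Finset.sum_boole, Fin.card_filter_val_lt]
    have := Int.mul_ediv_add_emod s n
    have hrn : min n r = r := by omega
    rw [hrn]
    simp
    omega

end EquidistributedTuples

section BlockSymmetric

variable {d : ℕ} {k : Fin d → ℕ}

/-- The sum of the coordinates of `v` in the block `i`. -/
def blockSum (v : (Σ i : Fin d, Fin (k i)) → ℝ) (i : Fin d) : ℝ := ∑ j, v ⟨i, j⟩

/-- Coordinates in the same block differ by at most one. -/
def IsBlockBalanced (v : (Σ i : Fin d, Fin (k i)) → ℝ) : Prop :=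
  ∀ i a b, v ⟨i, a⟩ ≤ v ⟨i, b⟩ + 1

theorem mem_permOrbit_blockSymmetricGroup {v w : (Σ i : Fin d, Fin (k i)) → ℝ} :
    w ∈ permOrbit (blockSymmetricGroup k) v ↔
      ∃ τ : ∀ i, Equiv.Perm (Fin (k i)), ∀ i j, w ⟨i, j⟩ = v ⟨i, τ i j⟩ := by
  constructor
  · rintro ⟨_, ⟨τ, rfl⟩, rfl⟩
    exact ⟨fun i => (τ i)⁻¹, fun i j => by rw [permAct, ← map_inv]; rfl⟩
  · rintro ⟨τ, h⟩
    refine ⟨_, ⟨τ⁻¹, rfl⟩, ?_⟩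
    ext ⟨i, j⟩
    rw [h, permAct, ← map_inv, inv_inv]
    rfl

theorem blockSum_eq_of_mem_permOrbit {v w : (Σ i : Fin d, Fin (k i)) → ℝ}
    (h : w ∈ permOrbit (blockSymmetricGroup k) v) : blockSum w = blockSum v := by
  obtain ⟨τ, hτ⟩ := mem_permOrbit_blockSymmetricGroup.1 h
  ext i
  simp only [blockSum, hτ]
  exact Equiv.sum_comp (τ i) fun j => v ⟨i, j⟩

theorem sum_sq_eq_of_mem_permOrbit {ι : Type*} [Fintype ι] {Γ : Subgroup (Equiv.Perm ι)}
    {v w : ι → ℝ} (h : w ∈ permOrbit Γ v) : ∑ p, w p ^ 2 = ∑ p, v p ^ 2 := by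
  obtain ⟨γ, -, rfl⟩ := h
  exact Equiv.sum_comp γ⁻¹ fun p => v p ^ 2

theorem IsBlockBalanced.of_mem_permOrbit {v w : (Σ i : Fin d, Fin (k i)) → ℝ}
    (hv : IsBlockBalanced v) (h : w ∈ permOrbit (blockSymmetricGroup k) v) :
    IsBlockBalanced w := by
  obtain ⟨τ, hτ⟩ := mem_permOrbit_blockSymmetricGroup.1 h
  intro i a b
  rw [hτ, hτ]
  exact hv i _ _

theorem IsIntegralPoint.of_mem_permOrbit {ι : Type*} {Γ : Subgroup (Equiv.Perm ι)}
    {v w : ι → ℝ} (hv : IsIntegralPoint v) (h : w ∈ permOrbit Γ v) : IsIntegralPoint w := by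
  obtain ⟨γ, -, rfl⟩ := h
  exact fun i => hv _

theorem blockSum_add (v w : (Σ i : Fin d, Fin (k i)) → ℝ) (i : Fin d) :
    blockSum (v + w) i = blockSum v i + blockSum w i := by
  simp [blockSum, Finset.sum_add_distrib]

theorem blockSum_smul (c : ℝ) (v : (Σ i : Fin d, Fin (k i)) → ℝ) (i : Fin d) :
    blockSum (c • v) i = c * blockSum v i := by
  simp [blockSum, Finset.mul_sum]

theorem blockSum_blockFixProj (v : (Σ i : Fin d, Fin (k i)) → ℝ) :
    blockSum (blockFixProj k v) = blockSum v := by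
  ext i
  have hne : (Nat.card (blockSymmetricGroup k) : ℝ) ≠ 0 := by
    exact_mod_cast Nat.card_pos.ne'
  set s := (Set.toFinite ((blockSymmetricGroup k : Subgroup _) :
    Set (Equiv.Perm (Σ i : Fin d, Fin (k i))))).toFinset with hs
  have hcard : s.card = Nat.card (blockSymmetricGroup k) := by
    rw [hs, ← Set.ncard_eq_toFinset_card]
    rfl
  have hsum : blockSum (∑ γ ∈ s, permAct γ v) i = ∑ γ ∈ s, blockSum (permAct γ v) i := by
    simp only [blockSum, Finset.sum_apply]
    exact Finset.sum_comm
  have hconst : ∑ γ ∈ s, blockSum (permAct γ v) i = ∑ _γ ∈ s, blockSum v i :=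
    Finset.sum_congr rfl fun γ hγ => congrFun
      (blockSum_eq_of_mem_permOrbit ⟨γ, (Set.Finite.mem_toFinset _).1 hγ, rfl⟩) i
  rw [blockFixProj, blockSum_smul, hsum, hconst, Finset.sum_const, hcard, nsmul_eq_mul,
    inv_mul_cancel_left₀ hne]

theorem blockFixProj_apply_perm (v : (Σ i : Fin d, Fin (k i)) → ℝ)
    {γ : Equiv.Perm (Σ i : Fin d, Fin (k i))} (hγ : γ ∈ blockSymmetricGroup k)
    (p : Σ i : Fin d, Fin (k i)) : blockFixProj k v (γ p) = blockFixProj k v p := by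
  simp only [blockFixProj, Pi.smul_apply, Finset.sum_apply]
  congr 1
  refine Finset.sum_equiv (Equiv.mulLeft γ⁻¹) (fun δ => ?_) fun δ _ => ?_
  · simp [Subgroup.mul_mem_cancel_left _ (inv_mem hγ)]
  · simp [permAct]

theorem blockFixProj_apply_eq (v : (Σ i : Fin d, Fin (k i)) → ℝ) (i : Fin d)
    (a b : Fin (k i)) : blockFixProj k v ⟨i, a⟩ = blockFixProj k v ⟨i, b⟩ := by
  classical
  have := blockFixProj_apply_perm v
    (γ := Equiv.Perm.sigmaCongrRightHom _ (Pi.mulSingle i (Equiv.swap b a))) ⟨_, rfl⟩ ⟨i, b⟩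
  simpa [Equiv.Perm.sigmaCongrRightHom] using this

/-- The fibers of the projection onto the fixed space are determined by the block sums. -/
theorem blockFixProj_eq_iff {v w : (Σ i : Fin d, Fin (k i)) → ℝ} :
    blockFixProj k v = blockFixProj k w ↔ blockSum v = blockSum w := by
  refine ⟨fun h => by rw [← blockSum_blockFixProj v, h, blockSum_blockFixProj], fun h => ?_⟩
  have card_mul : ∀ (u : (Σ i : Fin d, Fin (k i)) → ℝ) (i : Fin d) (j : Fin (k i)),
      (k i : ℝ) * blockFixProj k u ⟨i, j⟩ = blockSum u i := fun u i j => by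
    rw [← blockSum_blockFixProj, blockSum,
      Finset.sum_congr rfl fun a _ => blockFixProj_apply_eq u i a j]
    simp
  ext ⟨i, j⟩
  have hk : (k i : ℝ) ≠ 0 := by exact_mod_cast (Fin.pos j).ne'
  exact mul_left_cancel₀ hk (by rw [card_mul, card_mul, h])

theorem mem_permOrbit_of_blockSum_eq {v w : (Σ i : Fin d, Fin (k i)) → ℝ}
    (hv : IsIntegralPoint v) (hw : IsIntegralPoint w) (hv' : IsBlockBalanced v)
    (hw' : IsBlockBalanced w) (h : blockSum w = blockSum v) :
    w ∈ permOrbit (blockSymmetricGroup k) v := by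
  choose f hf using hv
  choose g hg using hw
  have (i : Fin d) : ∃ σ : Equiv.Perm (Fin (k i)), ∀ a, f ⟨i, σ a⟩ = g ⟨i, a⟩ := by
    refine exists_perm_of_sum_eq (f := fun a => g ⟨i, a⟩) (g := fun a => f ⟨i, a⟩) ?_ ?_ ?_
    · intro a b
      have := hw' i a b
      rw [hg, hg] at this
      exact_mod_cast this
    · intro a b
      have := hv' i a b
      rw [hf, hf] at this
      exact_mod_cast this
    · have := congrFun h i
      simp only [blockSum, hf, hg] at this
      exact_mod_cast this
  choose τ hτ using this
  exact mem_permOrbit_blockSymmetricGroup.2 ⟨τ, fun i j => by rw [hf, hg, hτ]⟩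

theorem convex_setOf_isBlockBalanced_and_blockSum_eq (s : Fin d → ℝ) :
    Convex ℝ {v : (Σ i : Fin d, Fin (k i)) → ℝ | IsBlockBalanced v ∧ blockSum v = s} := by
  rintro v ⟨hv, hvs⟩ w ⟨hw, hws⟩ a b ha hb hab
  refine ⟨fun i p q => ?_, ?_⟩
  · simp only [Pi.add_apply, Pi.smul_apply, smul_eq_mul]
    nlinarith [mul_le_mul_of_nonneg_left (hv i p q) ha, mul_le_mul_of_nonneg_left (hw i p q) hb]
  · ext i
    rw [blockSum_add, blockSum_smul, blockSum_smul, hvs, hws, ← add_mul, hab, one_mul]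

theorem permAct_one {ι : Type*} (v : ι → ℝ) : permAct 1 v = v := rfl

theorem IsCorePoint.isBlockBalanced {v : (Σ i : Fin d, Fin (k i)) → ℝ}
    (h : IsCorePoint (blockSymmetricGroup k) v) : IsBlockBalanced v := by
  classical
  intro i a b
  by_contra! hlt
  set p : Σ i : Fin d, Fin (k i) := ⟨i, a⟩ with hp
  set q : Σ i : Fin d, Fin (k i) := ⟨i, b⟩ with hq
  have hpq : p ≠ q := by
    intro e
    rw [e] at hlt
    linarith
  set y : (Σ i : Fin d, Fin (k i)) → ℝ := v - Pi.single p 1 + Pi.single q 1 with hy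
  have hyp : y p = v p - 1 := by simp [hy, hpq]
  have hyq : y q = v q + 1 := by simp [hy, hpq.symm]
  have hyr : ∀ r, r ≠ p → r ≠ q → y r = v r := fun r h1 h2 => by simp [hy, h1, h2]
  have hint : IsIntegralPoint y := by
    intro r
    obtain ⟨m, hm⟩ := h.1 r
    by_cases h1 : r = p
    · exact ⟨m - 1, by rw [h1, hyp, ← h1, hm]; push_cast; ring⟩
    by_cases h2 : r = q
    · exact ⟨m + 1, by rw [h2, hyq, ← h2, hm]; push_cast; ring⟩
    exact ⟨m, by rw [hyr r h1 h2, hm]⟩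
  set u : (Σ i : Fin d, Fin (k i)) → ℝ := fun r => v (Equiv.swap p q r) with hu
  have hmem : u ∈ permOrbit (blockSymmetricGroup k) v := by
    refine ⟨Equiv.swap p q, ⟨Pi.mulSingle i (Equiv.swap a b), ?_⟩, ?_⟩
    · ext1 ⟨i', j⟩
      rcases eq_or_ne i' i with rfl | hi
      · have : Equiv.swap p q ⟨i', j⟩ = ⟨i', Equiv.swap a b j⟩ := by
          simp only [Equiv.swap_apply_def, hp, hq, Sigma.mk.injEq, heq_eq_eq, true_and]
          split_ifs <;> rfl
        rw [this]
        simp [Equiv.Perm.sigmaCongrRightHom]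
      · rw [Equiv.swap_apply_of_ne_of_ne (by simp [hp, hi]) (by simp [hq, hi])]
        simp [Equiv.Perm.sigmaCongrRightHom, Pi.mulSingle_eq_of_ne hi]
    · ext r
      simp [hu, permAct]
  have hδ : 0 < v p - v q := by linarith
  have hhull : y ∈ convexHull ℝ (permOrbit (blockSymmetricGroup k) v) := by
    have hv : v ∈ permOrbit (blockSymmetricGroup k) v := ⟨1, one_mem _, (permAct_one v).symm⟩
    have ht : (v p - v q)⁻¹ ≤ 1 := inv_le_one_of_one_le₀ (by linarith)
    have hcomb : y = (1 - (v p - v q)⁻¹) • v + (v p - v q)⁻¹ • u := by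
      ext r
      simp only [Pi.add_apply, Pi.smul_apply, smul_eq_mul, hu]
      by_cases h1 : r = p
      · subst h1
        rw [hyp, Equiv.swap_apply_left]
        field_simp
        ring
      by_cases h2 : r = q
      · subst h2
        rw [hyq, Equiv.swap_apply_right]
        field_simp
        ring
      rw [hyr r h1 h2, Equiv.swap_apply_of_ne_of_ne h1 h2]
      ring
    rw [hcomb]
    exact convex_convexHull ℝ _ (subset_convexHull ℝ _ hv) (subset_convexHull ℝ _ hmem)
      (by linarith) (inv_nonneg.2 hδ.le) (by ring)
  have hsq := sum_sq_eq_of_mem_permOrbit (h.2 y hhull hint)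
  have hsplit : ∀ f : (Σ i : Fin d, Fin (k i)) → ℝ,
      ∑ r, f r = f p + (f q + ∑ r ∈ (Finset.univ.erase p).erase q, f r) := fun f => by
    rw [Finset.add_sum_erase _ _ (by simp [hpq.symm]), Finset.add_sum_erase _ _ (by simp)]
  rw [hsplit, hsplit fun r => v r ^ 2, hyp, hyq] at hsq
  have hrest : ∑ r ∈ (Finset.univ.erase p).erase q, y r ^ 2 =
      ∑ r ∈ (Finset.univ.erase p).erase q, v r ^ 2 :=
    Finset.sum_congr rfl fun r hr => by
      simp only [Finset.mem_erase] at hr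
      rw [hyr r hr.2.1 hr.1]
  linarith

/-- Core points of a product of symmetric groups are the integral points whose coordinates
differ by at most one within each block. -/
theorem isCorePoint_blockSymmetricGroup_iff {v : (Σ i : Fin d, Fin (k i)) → ℝ} :
    IsCorePoint (blockSymmetricGroup k) v ↔ IsIntegralPoint v ∧ IsBlockBalanced v := by
  refine ⟨fun h => ⟨h.1, h.isBlockBalanced⟩, fun h => ⟨h.1, fun y hy hint => ?_⟩⟩
  have hsub : permOrbit (blockSymmetricGroup k) v ⊆
      {w | IsBlockBalanced w ∧ blockSum w = blockSum v} :=
    fun w hw => ⟨h.2.of_mem_permOrbit hw, blockSum_eq_of_mem_permOrbit hw⟩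
  have := convexHull_min hsub (convex_setOf_isBlockBalanced_and_blockSum_eq _) hy
  exact mem_permOrbit_of_blockSum_eq h.1 hint h.2 this.1 this.2

theorem exists_isCorePoint_blockSum_eq (z₀ : (Σ i : Fin d, Fin (k i)) → ℤ) :
    ∃ z : (Σ i : Fin d, Fin (k i)) → ℝ, IsCorePoint (blockSymmetricGroup k) z ∧
      blockSum z = blockSum fun p => (z₀ p : ℝ) := by
  have (i : Fin d) : ∃ f : Fin (k i) → ℤ, (∀ a b, f a ≤ f b + 1) ∧
      ∑ a, f a = ∑ a, z₀ ⟨i, a⟩ := by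
    rcases Nat.eq_zero_or_pos (k i) with h | h
    · have : IsEmpty (Fin (k i)) := by rw [h]; infer_instance
      exact ⟨fun _ => 0, fun _ _ => by simp, by simp⟩
    · exact exists_sum_eq_of_le_add_one h _
  choose f hf hsum using this
  refine ⟨fun p => f p.1 p.2, isCorePoint_blockSymmetricGroup_iff.2
    ⟨fun p => ⟨_, rfl⟩, fun i a b => by dsimp only; exact_mod_cast hf i a b⟩, ?_⟩
  ext i
  simp only [blockSum]
  exact_mod_cast hsum i

end BlockSymmetric

/-- For Γ = S_{k₁} × ⋯ × S_{k_d} acting blockwise and every x in the image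
Φ_Γ(ℤ^n) of the integer lattice, the core points with respect to Γ contained in the fiber
Φ_Γ⁻¹(x) form a single Γ-orbit; in particular any two core points in the same fiber
differ by an element of Γ. -/
theorem core_points_in_fiber_form_single_orbit {d : ℕ} (k : Fin d → ℕ)
    (x : (Σ i : Fin d, Fin (k i)) → ℝ)
    (hx : ∃ z₀ : (Σ i : Fin d, Fin (k i)) → ℤ,
      x = blockFixProj k (fun p => (z₀ p : ℝ))) :
    ∃ z : (Σ i : Fin d, Fin (k i)) → ℝ,
      IsCorePoint (blockSymmetricGroup k) z ∧ blockFixProj k z = x ∧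
      ∀ w : (Σ i : Fin d, Fin (k i)) → ℝ,
        (IsCorePoint (blockSymmetricGroup k) w ∧ blockFixProj k w = x)
          ↔ ∃ γ ∈ blockSymmetricGroup k, w = permAct γ z := by
  obtain ⟨z₀, rfl⟩ := hx
  obtain ⟨z, hz, hsum⟩ := exists_isCorePoint_blockSum_eq z₀
  refine ⟨z, hz, blockFixProj_eq_iff.2 hsum, fun w => ?_⟩
  change _ ↔ w ∈ permOrbit (blockSymmetricGroup k) z
  rw [blockFixProj_eq_iff, ← hsum, isCorePoint_blockSymmetricGroup_iff]
  rw [isCorePoint_blockSymmetricGroup_iff] at hz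
  exact ⟨fun h => mem_permOrbit_of_blockSum_eq hz.1 h.1.1 hz.2 h.1.2 h.2,
    fun h => ⟨⟨hz.1.of_mem_permOrbit h, hz.2.of_mem_permOrbit h⟩,
      blockSum_eq_of_mem_permOrbit h⟩⟩
end
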